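/- arXiv:1805.05130 — 2 statements merged into one kernel-verified Lean document; each statement's English description precedes it below -/
import Mathlib

section
/- Let α = α_5 be the cocycle α_5(g₁,g₂,g₃) = exp((2πi/25) · ḡ₁(ḡ₂ + ḡ₃ − (g₂+g₃)‾)) on ℤ/5ℤ. Then ∑_{a ∈ ℤ/5ℤ} α(a,a,a)³ · α(a,2a,a) · α(3a,3a,3a) = −(√5)/2 + (i/4)(√(10+2√5) − √(10−2√5)). In particular this sum is not equal to 1, so the generalized Dijkgraaf–Witten invariants Z(m006) and Z(m007) = 1 (computed with G = ℤ/5ℤ and α) are distinct. -/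
/-- The standard 3-cocycle on `ℤ/mℤ` generating `H³(ℤ/mℤ, U(1)) ≅ ℤ/mℤ`:
`α_m(g₁,g₂,g₃) = exp((2πi/m²)·ḡ₁(ḡ₂ + ḡ₃ − (g₂+g₃)‾))`, where `x̄ = x.val` is the
canonical integer representative of `x ∈ ℤ/mℤ`. -/
noncomputable def alphaZMod (m : ℕ) (g₁ g₂ g₃ : ZMod m) : ℂ :=
  Complex.exp (2 * Real.pi * Complex.I / (m : ℂ) ^ 2 *
    ((g₁.val : ℂ) * ((g₂.val : ℂ) + (g₃.val : ℂ) - ((g₂ + g₃).val : ℂ))))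

theorem alphaZMod_eq_pow (m : ℕ) [NeZero m] (a b c : ZMod m) :
    alphaZMod m a b c =
      Complex.exp (2 * Real.pi * Complex.I / m) ^ (a.val * ((b.val + c.val) / m)) := by
  have hm : (m : ℂ) ≠ 0 := Nat.cast_ne_zero.mpr (NeZero.ne m)
  have h : (b.val : ℂ) + c.val - (b + c).val = m * ((b.val + c.val) / m : ℕ) := by
    rw [ZMod.val_add, sub_eq_iff_eq_add]
    exact_mod_cast (Nat.div_add_mod (b.val + c.val) m).symm
  rw [alphaZMod, h, ← Complex.exp_nat_mul]
  congr 1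
  push_cast
  field_simp

theorem stateSum_eq_pow :
    (∑ a : ZMod 5,
        (alphaZMod 5 a a a) ^ 3 * alphaZMod 5 a (2 * a) a *
          alphaZMod 5 (3 * a) (3 * a) (3 * a))
      = 1 + Complex.exp (2 * Real.pi * Complex.I / (5 : ℕ)) ^ 3 +
          Complex.exp (2 * Real.pi * Complex.I / (5 : ℕ)) ^ 2 +
          Complex.exp (2 * Real.pi * Complex.I / (5 : ℕ)) ^ 13 +
          Complex.exp (2 * Real.pi * Complex.I / (5 : ℕ)) ^ 16 := by
  simp_rw [alphaZMod_eq_pow, ← pow_mul, ← pow_add]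
  exact (Fin.sum_univ_five _).trans (by rw [← pow_zero (Complex.exp _)]; rfl)

theorem sin_pi_div_five : Real.sin (Real.pi / 5) = √(10 - 2 * √5) / 4 := by
  have h5 : √5 ^ 2 = 5 := Real.sq_sqrt (by norm_num)
  have hs : 0 ≤ Real.sin (Real.pi / 5) :=
    Real.sin_nonneg_of_nonneg_of_le_pi (by positivity) (by linarith [Real.pi_pos])
  have h := Real.sin_sq_add_cos_sq (Real.pi / 5)
  rw [Real.cos_pi_div_five] at h
  have : 10 - 2 * √5 = (4 * Real.sin (Real.pi / 5)) ^ 2 := by linear_combination -16 * h + h5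
  rw [this, Real.sqrt_sq (by positivity), mul_div_cancel_left₀ _ (by norm_num)]

theorem sin_two_mul_pi_div_five : Real.sin (2 * (Real.pi / 5)) = √(10 + 2 * √5) / 4 := by
  have h5 : √5 ^ 2 = 5 := Real.sq_sqrt (by norm_num)
  have hs : 0 ≤ Real.sin (2 * (Real.pi / 5)) :=
    Real.sin_nonneg_of_nonneg_of_le_pi (by positivity) (by linarith [Real.pi_pos])
  have h := Real.sin_sq_add_cos_sq (2 * (Real.pi / 5))
  rw [Real.cos_two_mul, Real.cos_pi_div_five] at h
  have : 10 + 2 * √5 = (4 * Real.sin (2 * (Real.pi / 5))) ^ 2 := by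
    linear_combination -16 * h + (√5 ^ 2 + 4 * √5 - 5) / 4 * h5
  rw [this, Real.sqrt_sq (by positivity), mul_div_cancel_left₀ _ (by norm_num)]


/-- The state sum computing the generalized Dijkgraaf–Witten invariant `Z(m006)` with
`G = ℤ/5ℤ` and a generator `α = α_5` of `H³(ℤ/5ℤ, U(1)) ≅ ℤ/5ℤ` equals
`−√5/2 + (i/4)(√(10+2√5) − √(10−2√5))`; in particular it differs from `Z(m007) = 1`. -/
theorem dw_m006_ne_m007 :
    (∑ a : ZMod 5,
        (alphaZMod 5 a a a) ^ 3 * alphaZMod 5 a (2 * a) a *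
          alphaZMod 5 (3 * a) (3 * a) (3 * a))
      = -((Real.sqrt 5 : ℂ)) / 2 +
          (Complex.I / 4) * ((Real.sqrt (10 + 2 * Real.sqrt 5) : ℂ) -
            (Real.sqrt (10 - 2 * Real.sqrt 5) : ℂ)) ∧
    (∑ a : ZMod 5,
        (alphaZMod 5 a a a) ^ 3 * alphaZMod 5 a (2 * a) a *
          alphaZMod 5 (3 * a) (3 * a) (3 * a)) ≠ 1 := by
  have h5 : √5 ^ 2 = 5 := Real.sq_sqrt (by norm_num)
  have key : (∑ a : ZMod 5,
        (alphaZMod 5 a a a) ^ 3 * alphaZMod 5 a (2 * a) a *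
          alphaZMod 5 (3 * a) (3 * a) (3 * a))
      = -((Real.sqrt 5 : ℂ)) / 2 +
          (Complex.I / 4) * ((Real.sqrt (10 + 2 * Real.sqrt 5) : ℂ) -
            (Real.sqrt (10 - 2 * Real.sqrt 5) : ℂ)) := by
    rw [stateSum_eq_pow]
    set ζ := Complex.exp (2 * Real.pi * Complex.I / (5 : ℕ)) with hζ
    have hζ5 : ζ ^ 5 = 1 := (Complex.isPrimitiveRoot_exp 5 (by norm_num)).pow_eq_one
    have h1 : ζ = (Real.cos (2 * (Real.pi / 5)) : ℂ) +
        (Real.sin (2 * (Real.pi / 5)) : ℂ) * Complex.I := by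
      rw [hζ, Complex.ofReal_cos, Complex.ofReal_sin, ← Complex.exp_mul_I]
      congr 1
      push_cast
      ring
    have h2 : ζ ^ 2 = ((-Real.cos (Real.pi / 5) : ℝ) : ℂ) +
        (Real.sin (Real.pi / 5) : ℂ) * Complex.I := by
      rw [hζ, ← Complex.exp_nat_mul, ← Real.cos_pi_sub, ← Real.sin_pi_sub,
        Complex.ofReal_cos, Complex.ofReal_sin, ← Complex.exp_mul_I]
      congr 1
      push_cast
      ring
    have h3 : ζ ^ 3 = ((-Real.cos (Real.pi / 5) : ℝ) : ℂ) -
        (Real.sin (Real.pi / 5) : ℂ) * Complex.I := by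
      have hsq : (Real.sin (Real.pi / 5) : ℂ) ^ 2 + ((-Real.cos (Real.pi / 5) : ℝ) : ℂ) ^ 2 = 1 :=
        by exact_mod_cast (neg_sq (Real.cos (Real.pi / 5))).symm ▸ Real.sin_sq_add_cos_sq (Real.pi / 5)
      have hne : ζ ^ 2 ≠ 0 := pow_ne_zero _ (Complex.exp_ne_zero _)
      refine mul_left_cancel₀ hne ?_
      rw [← pow_add, hζ5, h2]
      linear_combination -hsq + (Real.sin (Real.pi / 5) : ℂ) ^ 2 * Complex.I_sq
    have h13 : ζ ^ 13 = ζ ^ 3 := by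
      rw [show 13 = 5 * 2 + 3 from rfl, pow_add, pow_mul, hζ5, one_pow, one_mul]
    have h16 : ζ ^ 16 = ζ := by
      rw [show 16 = 5 * 3 + 1 from rfl, pow_add, pow_mul, hζ5, one_pow, one_mul, pow_one]
    have h5' : (√5 : ℂ) ^ 2 = 5 := mod_cast h5
    rw [h13, h16, h2, h3, h1, Real.cos_two_mul, Real.cos_pi_div_five, sin_pi_div_five,
      sin_two_mul_pi_div_five]
    push_cast
    linear_combination (1 / 8) * h5'
  refine ⟨key, fun h => ?_⟩
  have hre := congrArg Complex.re (key.symm.trans h)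
  simp at hre
  linarith [Real.sqrt_nonneg 5]
end

section
/- Let α = α_12 be the cocycle α_12(g₁,g₂,g₃) = exp((2πi/144) · ḡ₁(ḡ₂ + ḡ₃ − (g₂+g₃)‾)) on ℤ/12ℤ. Then ∑_{a ∈ ℤ/12ℤ} α(5a,a,2a) · α(6a,2a,3a) · α(8a,a,2a) · α(8a,a,8a)^{−1} · α(8a,5a,8a)^{−1} · α(8a,9a,8a)^{−1} · α(9a,5a,3a)^{−1} · α(9a,8a,a)^{−1} · α(9a,9a,5a) = 3 − 2√3. In particular, since 3 − 2√3 ≠ −6, the generalized Dijkgraaf–Witten invariants Z(s788) = 3 − 2√3 and Z(s778) = −6 (computed with G = ℤ/12ℤ and α) distinguish the cusped hyperbolic 3-manifolds s788 and s778, which have equal hyperbolic volumes and isomorphic first homology groups ℤ ⊕ ℤ/12ℤ. -/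
/-- The exponent of the cocycle: `α_m` takes the value `exp (2πi/m)` to the power of `ḡ₁` times
the carry of the addition `ḡ₂ + ḡ₃`. -/
def alphaExponent (m : ℕ) (g₁ g₂ g₃ : ZMod m) : ZMod m :=
  g₁ * ((g₂.val + g₃.val) / m : ℕ)

theorem alphaZMod_eq_stdAddChar (m : ℕ) [NeZero m] (g₁ g₂ g₃ : ZMod m) :
    alphaZMod m g₁ g₂ g₃ = ZMod.stdAddChar (alphaExponent m g₁ g₂ g₃) := by
  have hcast : alphaExponent m g₁ g₂ g₃ =
      ((g₁.val * ((g₂.val + g₃.val) / m) : ℕ) : ℤ) := by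
    rw [Int.cast_natCast, Nat.cast_mul, ZMod.natCast_zmod_val, alphaExponent]
  have hcarry : (g₂.val : ℂ) + g₃.val - (g₂ + g₃).val =
      m * ((g₂.val + g₃.val) / m : ℕ) := by
    rw [ZMod.val_add, sub_eq_iff_eq_add']
    exact_mod_cast (Nat.mod_add_div _ _).symm
  have hm : (m : ℂ) ≠ 0 := NeZero.ne _
  rw [hcast, ZMod.stdAddChar_coe, alphaZMod, hcarry]
  congr 1
  rw [Int.cast_natCast, Nat.cast_mul]
  field_simp

theorem stdAddChar_twelve_one :
    ZMod.stdAddChar (1 : ZMod 12) = (Real.sqrt 3 / 2 + Complex.I / 2 : ℂ) := by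
  have h : (1 : ZMod 12) = ((1 : ℤ) : ZMod 12) := by simp
  have harg : 2 * (Real.pi : ℂ) * Complex.I * ((1 : ℤ) : ℂ) / ((12 : ℕ) : ℂ) =
      ((Real.pi / 6 : ℝ) : ℂ) * Complex.I := by
    push_cast
    ring
  rw [h, ZMod.stdAddChar_coe, harg, Complex.exp_mul_I, ← Complex.ofReal_cos,
    ← Complex.ofReal_sin, Real.cos_pi_div_six, Real.sin_pi_div_six]
  push_cast
  ring

theorem stdAddChar_twelve_natCast (k : ℕ) :
    ZMod.stdAddChar (k : ZMod 12) = (Real.sqrt 3 / 2 + Complex.I / 2 : ℂ) ^ k := by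
  rw [← stdAddChar_twelve_one, ← AddChar.map_nsmul_eq_pow, nsmul_one]

/-- The exponent of the summand of the state sum of `s788` at each coloring. -/
theorem stateSumExponent_eq (a : ZMod 12) :
    alphaExponent 12 (5 * a) a (2 * a) + alphaExponent 12 (6 * a) (2 * a) (3 * a) +
      alphaExponent 12 (8 * a) a (2 * a) + -alphaExponent 12 (8 * a) a (8 * a) +
      -alphaExponent 12 (8 * a) (5 * a) (8 * a) + -alphaExponent 12 (8 * a) (9 * a) (8 * a) +
      -alphaExponent 12 (9 * a) (5 * a) (3 * a) + -alphaExponent 12 (9 * a) (8 * a) a +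
      alphaExponent 12 (9 * a) (9 * a) (5 * a) =
    ((![0, 5, 8, 3, 0, 7, 0, 5, 4, 9, 0, 7] : Fin 12 → ℕ) a : ZMod 12) := by
  revert a
  decide

/-- The state sum computing the generalized Dijkgraaf–Witten invariant `Z(s788)` with
`G = ℤ/12ℤ` and a generator `α = α_12` of `H³(ℤ/12ℤ, U(1)) ≅ ℤ/12ℤ` equals `3 − 2√3`;
since `3 − 2√3 ≠ −6 = Z(s778)`, the generalized Dijkgraaf–Witten invariants
distinguish `s788` and `s778`. -/
theorem dw_s788_ne_s778 :
    (∑ a : ZMod 12,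
        alphaZMod 12 (5 * a) a (2 * a) * alphaZMod 12 (6 * a) (2 * a) (3 * a) *
          alphaZMod 12 (8 * a) a (2 * a) * (alphaZMod 12 (8 * a) a (8 * a))⁻¹ *
          (alphaZMod 12 (8 * a) (5 * a) (8 * a))⁻¹ *
          (alphaZMod 12 (8 * a) (9 * a) (8 * a))⁻¹ *
          (alphaZMod 12 (9 * a) (5 * a) (3 * a))⁻¹ *
          (alphaZMod 12 (9 * a) (8 * a) a)⁻¹ * alphaZMod 12 (9 * a) (9 * a) (5 * a))
      = 3 - 2 * (Real.sqrt 3 : ℂ) ∧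
    (3 - 2 * (Real.sqrt 3 : ℂ)) ≠ -6 := by
  constructor
  · simp only [alphaZMod_eq_stdAddChar, ← AddChar.map_neg_eq_inv, ← AddChar.map_add_eq_mul,
      stateSumExponent_eq, stdAddChar_twelve_natCast]
    have hsqrt : (Real.sqrt 3 : ℂ) ^ 2 = 3 := by
      exact_mod_cast Real.sq_sqrt (by norm_num : (0 : ℝ) ≤ 3)
    have hcube : (Real.sqrt 3 / 2 + Complex.I / 2 : ℂ) ^ 3 = Complex.I := by
      linear_combination (Real.sqrt 3 / 8 + 3 / 8 * Complex.I) * hsqrt +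
        (3 / 8 * Real.sqrt 3 + Complex.I / 8) * Complex.I_sq
    have hsq : (Real.sqrt 3 / 2 + Complex.I / 2 : ℂ) ^ 2 =
        1 / 2 + Real.sqrt 3 / 2 * Complex.I := by
      linear_combination hsqrt / 4 + Complex.I_sq / 4
    have hsum (z : ℂ) :
        ∑ a : ZMod 12, z ^ (![0, 5, 8, 3, 0, 7, 0, 5, 4, 9, 0, 7] : Fin 12 → ℕ) a =
          4 + z ^ 3 + z ^ 3 * z + 2 * (z ^ 3 * z ^ 2) + 2 * ((z ^ 3) ^ 2 * z) +
            (z ^ 3) ^ 2 * z ^ 2 + (z ^ 3) ^ 3 := by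
      change ∑ a : Fin 12, z ^ (![0, 5, 8, 3, 0, 7, 0, 5, 4, 9, 0, 7] : Fin 12 → ℕ) a = _
      simp [Fin.sum_univ_succ]
      ring
    rw [hsum, hcube, hsq]
    ring_nf
    simp only [Complex.I_sq, Complex.I_pow_three]
    ring
  · intro h
    have hreal : 3 - 2 * Real.sqrt 3 = -6 := by exact_mod_cast h
    nlinarith [Real.sq_sqrt (by norm_num : (0 : ℝ) ≤ 3)]
end
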